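/- arXiv:1912.01649 — 3 statements merged into one kernel-verified Lean document; each statement's English description precedes it below -/
import Mathlib

section
/- Let M = ⟨S, A, P, R, H, ρ₀⟩ be a finite-horizon episodic MDP, let Ŝ ⊆ S, and let M̂ be the corresponding e-stop MDP. Let π* be a policy maximizing J_M over all policies and let π̂* be a policy maximizing J_{M̂} over all policies. Then for any policy π_e and any finite sequence of policies π₁, …, π_K, the cumulative regret decomposes as: Σ_{k=1}^{K} (J_M(π_e) − J_M(π_k)) ≤ K · (J_M(π*) − J_{M̂}(π̂*)) + Σ_{k=1}^{K} (J_{M̂}(π̂*) − J_{M̂}(π_k)); that is, the regret against the expert in M is bounded by an asymptotic sub-optimality term plus the learning regret measured in the e-stop MDP M̂. -/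
open Finset

/-- A finite-horizon episodic MDP `⟨S, A, P, R, H, ρ₀⟩`. -/
structure MDP (S A : Type*) [Fintype S] [Fintype A] where
  P : S → A → S → ℝ
  P_nonneg : ∀ s a s', 0 ≤ P s a s'
  P_sum : ∀ s a, ∑ s' : S, P s a s' = 1
  R : S → A → S → ℝ
  R_nonneg : ∀ s a s', 0 ≤ R s a s'
  R_le_one : ∀ s a s', R s a s' ≤ 1
  H : ℕ
  H_pos : 0 < H
  ρ0 : S → ℝ
  ρ0_nonneg : ∀ s, 0 ≤ ρ0 s
  ρ0_sum : ∑ s : S, ρ0 s = 1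

/-- A (time-dependent, stochastic) policy. -/
structure Policy (S A : Type*) [Fintype A] where
  p : ℕ → S → A → ℝ
  nonneg : ∀ t s a, 0 ≤ p t s a
  sum_one : ∀ t s, ∑ a : A, p t s a = 1

/-- The time-`t` state distribution `ρ_π^t`. -/
noncomputable def stateDist {S A : Type*} [Fintype S] [Fintype A]
    (P : S → A → S → ℝ) (pol : ℕ → S → A → ℝ) (ρ0 : S → ℝ) : ℕ → S → ℝ
  | 0 => ρ0
  | t + 1 => fun s => ∑ s' : S, ∑ a : A, stateDist P pol ρ0 t s' * pol t s' a * P s' a s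

/-- Expected cumulative reward `J = ∑_{t=0}^{H-2} ∑_{s,a,s'} ρ^t(s) π(a|s,t) P(s,a,s') R(s,a,s')`. -/
noncomputable def valueJ {S A : Type*} [Fintype S] [Fintype A]
    (P : S → A → S → ℝ) (R : S → A → S → ℝ) (H : ℕ) (ρ0 : S → ℝ)
    (pol : ℕ → S → A → ℝ) : ℝ :=
  ∑ t ∈ Finset.range (H - 1), ∑ s : S, ∑ a : A, ∑ s' : S,
    stateDist P pol ρ0 t s * pol t s a * P s a s' * R s a s'

/-- `J_M(π)`. -/
noncomputable def MDP.J {S A : Type*} [Fintype S] [Fintype A]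
    (M : MDP S A) (π : Policy S A) : ℝ :=
  valueJ M.P M.R M.H M.ρ0 π.p

/-- State space `Ŝ ∪ {s_term}` of the e-stop MDP; `none` is the absorbing state `s_term`. -/
abbrev EState (S : Type*) (Shat : Finset S) := Option {s : S // s ∈ Shat}

/-- Transition kernel of the e-stop MDP. -/
noncomputable def estopP {S A : Type*} [Fintype S] [DecidableEq S]
    (P : S → A → S → ℝ) (Shat : Finset S) :
    EState S Shat → A → EState S Shat → ℝ
  | some s, a, some s' => P s.1 a s'.1
  | some s, a, none => ∑ s' ∈ Shatᶜ, P s.1 a s'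
  | none, _, some _ => 0
  | none, _, none => 1

/-- Reward of the e-stop MDP: zero on any transition into or out of `s_term`. -/
noncomputable def estopR {S A : Type*} (R : S → A → S → ℝ) (Shat : Finset S) :
    EState S Shat → A → EState S Shat → ℝ
  | some s, a, some s' => R s.1 a s'.1
  | _, _, _ => 0

/-- Initial distribution of the e-stop MDP. -/
noncomputable def estopρ0 {S : Type*} [Fintype S] [DecidableEq S]
    (ρ0 : S → ℝ) (Shat : Finset S) : EState S Shat → ℝ
  | some s => ρ0 s.1
  | none => ∑ s ∈ Shatᶜ, ρ0 s

/-- The policy induced on the e-stop MDP by restriction (acting uniformly at `s_term`). -/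
noncomputable def estopPol {S A : Type*} [Fintype A]
    (pol : ℕ → S → A → ℝ) (Shat : Finset S) :
    ℕ → EState S Shat → A → ℝ :=
  fun t s a => match s with
    | some s => pol t s.1 a
    | none => (Fintype.card A : ℝ)⁻¹

/-- `J_{M̂}(π)`: expected cumulative reward of (the restriction of) `π` in the e-stop MDP. -/
noncomputable def estopJ {S A : Type*} [Fintype S] [DecidableEq S] [Fintype A]
    (M : MDP S A) (Shat : Finset S) (π : Policy S A) : ℝ :=
  valueJ (estopP M.P Shat) (estopR M.R Shat) M.H (estopρ0 M.ρ0 Shat) (estopPol π.p Shat)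

/-- Probability of the trajectory `τ = (τ₀, …, τ_{H-1})` under policy `π` in `M`. -/
noncomputable def trajProb {S A : Type*} [Fintype S] [Fintype A]
    (M : MDP S A) (π : Policy S A) (τ : Fin M.H → S) : ℝ :=
  M.ρ0 (τ ⟨0, M.H_pos⟩) *
    ∏ t : Fin (M.H - 1), ∑ a : A,
      π.p t.1 (τ ⟨t.1, Nat.lt_of_lt_of_le t.2 (Nat.sub_le _ _)⟩) a *
        M.P (τ ⟨t.1, Nat.lt_of_lt_of_le t.2 (Nat.sub_le _ _)⟩) a
          (τ ⟨t.1 + 1, by have := t.2; omega⟩)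

/-- Hitting probability `h(s)`: the probability that `π` visits `s` during an episode. -/
noncomputable def hitProb {S A : Type*} [Fintype S] [DecidableEq S] [Fintype A]
    (M : MDP S A) (π : Policy S A) (s : S) : ℝ :=
  ∑ τ : Fin M.H → S, trajProb M π τ * (if ∃ t, τ t = s then 1 else 0)

/-- Average state distribution `ρ_π(s) = (1/H) ∑_{t=0}^{H-1} ρ_π^t(s)`. -/
noncomputable def avgDist {S A : Type*} [Fintype S] [Fintype A]
    (M : MDP S A) (π : Policy S A) (s : S) : ℝ :=
  (M.H : ℝ)⁻¹ * ∑ t ∈ Finset.range M.H, stateDist M.P π.p M.ρ0 t s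
theorem stateDist_nonneg {S A : Type*} [Fintype S] [Fintype A]
    {P : S → A → S → ℝ} {pol : ℕ → S → A → ℝ} {ρ0 : S → ℝ}
    (hP : ∀ s a s', 0 ≤ P s a s') (hpol : ∀ t s a, 0 ≤ pol t s a) (hρ0 : ∀ s, 0 ≤ ρ0 s)
    (t : ℕ) (s : S) : 0 ≤ stateDist P pol ρ0 t s := by
  induction t generalizing s with
  | zero => exact hρ0 s
  | succ t ih =>
    exact sum_nonneg fun s' _ => sum_nonneg fun a _ =>
      mul_nonneg (mul_nonneg (ih s') (hpol t s' a)) (hP s' a s)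

theorem sum_subtype_le_sum {S : Type*} [Fintype S] (Shat : Finset S)
    {f : {s : S // s ∈ Shat} → ℝ} {g : S → ℝ} (hfg : ∀ s, f s ≤ g s.1) (hg : ∀ s, 0 ≤ g s) :
    ∑ s, f s ≤ ∑ s, g s :=
  calc ∑ s, f s ≤ ∑ s : {s : S // s ∈ Shat}, g s.1 := sum_le_sum fun s _ => hfg s
    _ = ∑ s ∈ Shat, g s := sum_coe_sort Shat g
    _ ≤ ∑ s, g s := sum_le_univ_sum_of_nonneg hg

/-- On the retained states, the e-stop state distribution is dominated by the original one. -/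
theorem stateDist_estop_le {S A : Type*} [Fintype S] [DecidableEq S] [Fintype A]
    (M : MDP S A) (Shat : Finset S) (π : Policy S A) (t : ℕ) (s : {s : S // s ∈ Shat}) :
    stateDist (estopP M.P Shat) (estopPol π.p Shat) (estopρ0 M.ρ0 Shat) t (some s) ≤
      stateDist M.P π.p M.ρ0 t s.1 := by
  induction t generalizing s with
  | zero => exact le_rfl
  | succ t ih =>
    simp only [stateDist, Fintype.sum_option, estopP, estopPol, mul_zero, sum_const_zero, zero_add]
    refine sum_subtype_le_sum Shat (fun s' => sum_le_sum fun a _ => ?_) fun s' =>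
      sum_nonneg fun a _ => mul_nonneg (mul_nonneg
        (stateDist_nonneg M.P_nonneg π.nonneg M.ρ0_nonneg t s') (π.nonneg t s' a))
        (M.P_nonneg s' a s)
    exact mul_le_mul_of_nonneg_right (mul_le_mul_of_nonneg_right (ih s') (π.nonneg t s' a))
      (M.P_nonneg s' a s)

/-- Early stopping never increases the value of a policy. -/
theorem estopJ_le_J {S A : Type*} [Fintype S] [DecidableEq S] [Fintype A]
    (M : MDP S A) (Shat : Finset S) (π : Policy S A) : estopJ M Shat π ≤ M.J π := by
  have hterm (t : ℕ) (s : S) (a : A) (s' : S) :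
      0 ≤ stateDist M.P π.p M.ρ0 t s * π.p t s a * M.P s a s' * M.R s a s' :=
    mul_nonneg (mul_nonneg (mul_nonneg
      (stateDist_nonneg M.P_nonneg π.nonneg M.ρ0_nonneg t s) (π.nonneg t s a))
      (M.P_nonneg s a s')) (M.R_nonneg s a s')
  unfold estopJ MDP.J valueJ
  refine sum_le_sum fun t _ => ?_
  simp only [Fintype.sum_option, estopP, estopR, estopPol, mul_zero, sum_const_zero, zero_add]
  refine sum_subtype_le_sum Shat (fun s => sum_le_sum fun a _ => ?_) fun s =>
    sum_nonneg fun a _ => sum_nonneg fun s' _ => hterm t s a s'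
  refine sum_subtype_le_sum Shat (fun s' => ?_) fun s' => hterm t s a s'
  exact mul_le_mul_of_nonneg_right (mul_le_mul_of_nonneg_right (mul_le_mul_of_nonneg_right
    (stateDist_estop_le M Shat π t s) (π.nonneg t s a)) (M.P_nonneg s a s')) (M.R_nonneg s a s')

/-- regret decomposition into asymptotic sub-optimality plus learning regret. -/
theorem regret_decomposition
    {S A : Type*} [Fintype S] [DecidableEq S] [Fintype A]
    (M : MDP S A) (Shat : Finset S)
    (πstar : Policy S A) (hπstar : ∀ π : Policy S A, M.J π ≤ M.J πstar)
    (πhatstar : Policy S A)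
    (hπhatstar : ∀ π : Policy S A, estopJ M Shat π ≤ estopJ M Shat πhatstar)
    (πe : Policy S A) (K : ℕ) (πs : Fin K → Policy S A) :
    ∑ k : Fin K, (M.J πe - M.J (πs k)) ≤
      (K : ℝ) * (M.J πstar - estopJ M Shat πhatstar) +
        ∑ k : Fin K, (estopJ M Shat πhatstar - estopJ M Shat (πs k)) := by
  have hbound (k : Fin K) : M.J πe - M.J (πs k) ≤ (M.J πstar - estopJ M Shat πhatstar) +
      (estopJ M Shat πhatstar - estopJ M Shat (πs k)) := by
    linarith [hπstar πe, estopJ_le_J M Shat (πs k)]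
  calc ∑ k : Fin K, (M.J πe - M.J (πs k))
      ≤ ∑ k : Fin K, ((M.J πstar - estopJ M Shat πhatstar) +
          (estopJ M Shat πhatstar - estopJ M Shat (πs k))) := sum_le_sum fun k _ => hbound k
    _ = _ := by
      rw [sum_add_distrib, sum_const, card_univ, Fintype.card_fin, nsmul_eq_mul]
end

section
/- Let M = ⟨S, A, P, R, H, ρ₀⟩ be a finite-horizon episodic MDP with expert policy π_e, let Ŝ ⊆ S be an arbitrary subset, let M̂ be the corresponding e-stop MDP, and let π̂* be a policy maximizing J_{M̂} over all policies. Then the asymptotic sub-optimality is bounded in terms of the average state distribution of the expert on the removed states: J_M(π_e) − J_M(π̂*) ≤ H² · Σ_{s ∈ S∖Ŝ} ρ_{π_e}(s). -/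
open Finset

/-- Distribution over non-terminated states of `M` stopped outside `Shat`, as a function on `S`. -/
noncomputable def survivingDist {S A : Type*} [Fintype S] [DecidableEq S] [Fintype A]
    (M : MDP S A) (Shat : Finset S) (π : Policy S A) : ℕ → S → ℝ
  | 0 => fun s => if s ∈ Shat then M.ρ0 s else 0
  | t + 1 => fun s => if s ∈ Shat then
      ∑ s' : S, ∑ a : A, survivingDist M Shat π t s' * π.p t s' a * M.P s' a s else 0

section

variable {S A : Type*} [Fintype S] [Fintype A] (M : MDP S A) (π : Policy S A)

theorem sum_transition (t : ℕ) (f : S → ℝ) :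
    ∑ s : S, ∑ s' : S, ∑ a : A, f s' * π.p t s' a * M.P s' a s = ∑ s : S, f s := by
  rw [Finset.sum_comm]
  refine Finset.sum_congr rfl fun s' _ => ?_
  rw [Finset.sum_comm]
  simp_rw [← Finset.mul_sum, M.P_sum, mul_one, ← Finset.mul_sum, π.sum_one, mul_one]

theorem sum_stateDist (t : ℕ) : ∑ s : S, stateDist M.P π.p M.ρ0 t s = 1 := by
  induction t with
  | zero => exact M.ρ0_sum
  | succ t ih => exact (sum_transition M π t _).trans ih

theorem stateDist_nonneg_s3 (t : ℕ) (s : S) : 0 ≤ stateDist M.P π.p M.ρ0 t s := by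
  induction t generalizing s with
  | zero => exact M.ρ0_nonneg s
  | succ t ih =>
    exact Finset.sum_nonneg fun s' _ => Finset.sum_nonneg fun a _ =>
      mul_nonneg (mul_nonneg (ih s') (π.nonneg t s' a)) (M.P_nonneg s' a s)

variable [DecidableEq S] (Shat : Finset S)

theorem survivingDist_of_notMem (t : ℕ) {s : S} (hs : s ∉ Shat) :
    survivingDist M Shat π t s = 0 := by
  cases t <;> simp [survivingDist, hs]

theorem survivingDist_nonneg (t : ℕ) (s : S) : 0 ≤ survivingDist M Shat π t s := by
  induction t generalizing s with
  | zero =>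
    simp only [survivingDist]
    split_ifs
    exacts [M.ρ0_nonneg s, le_rfl]
  | succ t ih =>
    simp only [survivingDist]
    split_ifs
    · exact Finset.sum_nonneg fun s' _ => Finset.sum_nonneg fun a _ =>
        mul_nonneg (mul_nonneg (ih s') (π.nonneg t s' a)) (M.P_nonneg s' a s)
    · exact le_rfl

theorem survivingDist_le_stateDist (t : ℕ) (s : S) :
    survivingDist M Shat π t s ≤ stateDist M.P π.p M.ρ0 t s := by
  induction t generalizing s with
  | zero =>
    simp only [survivingDist]
    split_ifs
    exacts [le_rfl, M.ρ0_nonneg s]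
  | succ t ih =>
    simp only [survivingDist]
    split_ifs
    · exact Finset.sum_le_sum fun s' _ => Finset.sum_le_sum fun a _ =>
        mul_le_mul_of_nonneg_right (mul_le_mul_of_nonneg_right (ih s') (π.nonneg t s' a))
          (M.P_nonneg s' a s)
    · exact stateDist_nonneg_s3 M π (t + 1) s

theorem sum_survivingDist_mul (t : ℕ) (g : S → ℝ) :
    ∑ s : S, survivingDist M Shat π t s * g s = ∑ s ∈ Shat, survivingDist M Shat π t s * g s :=
  (Finset.sum_subset (Finset.subset_univ _) fun s _ hs => by
    rw [survivingDist_of_notMem M π Shat t hs, zero_mul]).symm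

theorem stateDist_estop_some (t : ℕ) (s : {s : S // s ∈ Shat}) :
    stateDist (estopP M.P Shat) (estopPol π.p Shat) (estopρ0 M.ρ0 Shat) t (some s) =
      survivingDist M Shat π t s := by
  induction t generalizing s with
  | zero => simp [stateDist, estopρ0, survivingDist]
  | succ t ih =>
    simp only [stateDist, survivingDist, if_pos s.2, Fintype.sum_option, estopP, estopPol, ih,
      mul_zero, Finset.sum_const_zero, zero_add]
    simp_rw [mul_assoc, ← Finset.mul_sum]
    rw [sum_survivingDist_mul]
    exact Finset.sum_coe_sort Shat
      (fun s' => survivingDist M Shat π t s' * ∑ a : A, π.p t s' a * M.P s' a s)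

theorem estopJ_eq_sum_survivingDist :
    estopJ M Shat π = ∑ t ∈ Finset.range (M.H - 1), ∑ s : S, ∑ a : A, ∑ s' : S,
      if s' ∈ Shat then survivingDist M Shat π t s * π.p t s a * M.P s a s' * M.R s a s'
      else 0 := by
  rw [estopJ, valueJ]
  refine Finset.sum_congr rfl fun t _ => ?_
  rw [Fintype.sum_option]
  simp only [Fintype.sum_option, estopR, estopP, estopPol, stateDist_estop_some, mul_zero,
    Finset.sum_const_zero, zero_add, Finset.sum_ite_mem, Finset.univ_inter]
  have h (s : S) (a : A) := Finset.sum_coe_sort Shat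
    (fun s' => survivingDist M Shat π t s * π.p t s a * M.P s a s' * M.R s a s')
  simp_rw [h]
  rw [Finset.sum_coe_sort Shat (fun s => ∑ a : A, ∑ s' ∈ Shat,
    survivingDist M Shat π t s * π.p t s a * M.P s a s' * M.R s a s')]
  refine Finset.sum_subset (Finset.subset_univ _) fun s _ hs => ?_
  simp [survivingDist_of_notMem M π Shat t hs]

/-- Stopping episodes early can only lose reward. -/
theorem estopJ_le_J_s3 : estopJ M Shat π ≤ M.J π := by
  rw [estopJ_eq_sum_survivingDist, MDP.J, valueJ]
  refine Finset.sum_le_sum fun t _ => Finset.sum_le_sum fun s _ => Finset.sum_le_sum fun a _ =>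
    Finset.sum_le_sum fun s' _ => ?_
  have hπ := π.nonneg t s a
  have hP := M.P_nonneg s a s'
  have hR := M.R_nonneg s a s'
  split_ifs
  · gcongr
    exact survivingDist_le_stateDist M π Shat t s
  · have := stateDist_nonneg_s3 M π t s
    positivity

/-- Union bound on the probability of having been terminated by time `t`. -/
theorem one_sub_sum_survivingDist_le (t : ℕ) :
    1 - ∑ s : S, survivingDist M Shat π t s ≤
      ∑ i ∈ Finset.range (t + 1), ∑ s ∈ Shatᶜ, stateDist M.P π.p M.ρ0 i s := by
  induction t with
  | zero =>
    have := sum_stateDist M π 0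
    rw [← Finset.sum_add_sum_compl Shat] at this
    simp only [survivingDist, Finset.sum_ite_mem, Finset.univ_inter, zero_add,
      Finset.sum_range_one]
    simp only [stateDist] at this ⊢
    linarith
  | succ t ih =>
    rw [Finset.sum_range_succ]
    have htotal := sum_stateDist M π (t + 1)
    rw [← Finset.sum_add_sum_compl Shat] at htotal
    have hstep := sum_transition M π t
      (fun s => stateDist M.P π.p M.ρ0 t s - survivingDist M Shat π t s)
    rw [Finset.sum_sub_distrib, sum_stateDist] at hstep
    have hsub : ∑ s ∈ Shat, ∑ s' : S, ∑ a : A,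
        (stateDist M.P π.p M.ρ0 t s' - survivingDist M Shat π t s') * π.p t s' a * M.P s' a s ≤
        ∑ s : S, ∑ s' : S, ∑ a : A,
        (stateDist M.P π.p M.ρ0 t s' - survivingDist M Shat π t s') * π.p t s' a * M.P s' a s :=
      Finset.sum_le_sum_of_subset_of_nonneg (Finset.subset_univ _) fun s _ _ =>
        Finset.sum_nonneg fun s' _ => Finset.sum_nonneg fun a _ =>
          mul_nonneg (mul_nonneg (sub_nonneg.2 (survivingDist_le_stateDist M π Shat t s'))
            (π.nonneg t s' a)) (M.P_nonneg s' a s)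
    have hsplit : ∑ s ∈ Shat, ∑ s' : S, ∑ a : A,
        (stateDist M.P π.p M.ρ0 t s' - survivingDist M Shat π t s') * π.p t s' a * M.P s' a s =
        ∑ s ∈ Shat, stateDist M.P π.p M.ρ0 (t + 1) s -
          ∑ s : S, survivingDist M Shat π (t + 1) s := by
      simp only [survivingDist, Finset.sum_ite_mem, Finset.univ_inter, stateDist, sub_mul,
        Finset.sum_sub_distrib]
    linarith

/-- The reward lost at step `t` is at most the probability of termination by time `t + 1`. -/
theorem reward_sub_le_one_sub_sum_survivingDist (t : ℕ) :
    (∑ s : S, ∑ a : A, ∑ s' : S,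
      stateDist M.P π.p M.ρ0 t s * π.p t s a * M.P s a s' * M.R s a s') -
    (∑ s : S, ∑ a : A, ∑ s' : S,
      if s' ∈ Shat then survivingDist M Shat π t s * π.p t s a * M.P s a s' * M.R s a s'
      else 0) ≤ 1 - ∑ s : S, survivingDist M Shat π (t + 1) s := by
  have hρ : ∑ s : S, ∑ a : A, ∑ s' : S,
      stateDist M.P π.p M.ρ0 t s * π.p t s a * M.P s a s' = 1 := by
    simp_rw [← Finset.mul_sum, M.P_sum, mul_one, ← Finset.mul_sum, π.sum_one, mul_one]
    exact sum_stateDist M π t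
  have hσ : ∑ s : S, survivingDist M Shat π (t + 1) s = ∑ s : S, ∑ a : A, ∑ s' : S,
      if s' ∈ Shat then survivingDist M Shat π t s * π.p t s a * M.P s a s' else 0 := by
    simp only [survivingDist, Finset.sum_ite_mem, Finset.univ_inter]
    rw [Finset.sum_comm]
    exact Finset.sum_congr rfl fun s _ => Finset.sum_comm
  rw [← hρ, hσ]
  simp only [← Finset.sum_sub_distrib]
  refine Finset.sum_le_sum fun s _ => Finset.sum_le_sum fun a _ =>
    Finset.sum_le_sum fun s' _ => ?_
  have hR := M.R_le_one s a s'
  have hπP := mul_nonneg (π.nonneg t s a) (M.P_nonneg s a s')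
  split_ifs
  · have := mul_nonneg (mul_nonneg
      (sub_nonneg.2 (survivingDist_le_stateDist M π Shat t s)) hπP) (sub_nonneg.2 hR)
    linarith
  · have := mul_nonneg (mul_nonneg (stateDist_nonneg_s3 M π t s) hπP) (sub_nonneg.2 hR)
    linarith

theorem J_sub_estopJ_le :
    M.J π - estopJ M Shat π ≤ (M.H : ℝ) ^ 2 * ∑ s ∈ Shatᶜ, avgDist M π s := by
  have hH : (M.H : ℝ) ≠ 0 := Nat.cast_ne_zero.2 M.H_pos.ne'
  set B := ∑ i ∈ Finset.range M.H, ∑ s ∈ Shatᶜ, stateDist M.P π.p M.ρ0 i s with hB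
  have hnonneg (i : ℕ) : 0 ≤ ∑ s ∈ Shatᶜ, stateDist M.P π.p M.ρ0 i s :=
    Finset.sum_nonneg fun s _ => stateDist_nonneg_s3 M π i s
  have hB0 : 0 ≤ B := Finset.sum_nonneg fun i _ => hnonneg i
  have havg : (M.H : ℝ) ^ 2 * ∑ s ∈ Shatᶜ, avgDist M π s = M.H * B := by
    simp only [avgDist, ← Finset.mul_sum]
    rw [Finset.sum_comm, ← hB]
    field_simp
  rw [havg, estopJ_eq_sum_survivingDist, MDP.J, valueJ, ← Finset.sum_sub_distrib]
  have hterm : ∀ t ∈ Finset.range (M.H - 1), _ ≤ B := fun t ht =>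
    (reward_sub_le_one_sub_sum_survivingDist M π Shat t).trans <|
      (one_sub_sum_survivingDist_le M π Shat (t + 1)).trans <|
        Finset.sum_le_sum_of_subset_of_nonneg
          (Finset.range_subset_range.2 (by have := Finset.mem_range.1 ht; omega))
          fun i _ _ => hnonneg i
  refine (Finset.sum_le_card_nsmul _ _ B hterm).trans ?_
  rw [Finset.card_range, nsmul_eq_mul]
  gcongr
  exact Nat.sub_le _ _

end

/-- imperfect e-stops in terms of the expert's average state distribution. -/
theorem imperfect_estop_stationary
    {S A : Type*} [Fintype S] [DecidableEq S] [Fintype A]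
    (M : MDP S A) (πe : Policy S A) (Shat : Finset S)
    (πhatstar : Policy S A)
    (hπhatstar : ∀ π : Policy S A, estopJ M Shat π ≤ estopJ M Shat πhatstar) :
    M.J πe - M.J πhatstar ≤ (M.H : ℝ) ^ 2 * ∑ s ∈ Shatᶜ, avgDist M πe s := by
  linarith [hπhatstar πe, estopJ_le_J_s3 M πhatstar Shat, J_sub_estopJ_le M πe Shat]
end

section
/- Let M = ⟨S, A, P, R, H, ρ₀⟩ be a finite-horizon episodic MDP with expert policy π_e. Fix ξ ≥ 0 and ε > 0, and draw n trajectories τ^{(1)},…,τ^{(n)} i.i.d. from the trajectory distribution p of π_e, forming the empirical hitting probabilities ĥ. Let Ŝ ⊆ S be any (possibly sample-dependent) subset satisfying Σ_{s∈S∖Ŝ} ĥ(s) ≤ ξ, let M̂ be the corresponding e-stop MDP, and let π̂* be a policy maximizing J_{M̂} over all policies. Then, with probability at least 1 − |S| · exp(−2ε²n/|S|²) over the draw of the n trajectories, J_M(π_e) − J_M(π̂*) ≤ (ξ + ε) · H. -/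
open Finset

/-- The empirical hitting probability `ĥ(s)` from `n` sampled trajectories. -/
noncomputable def empHit {S : Type*} [Fintype S] [DecidableEq S] {H n : ℕ}
    (ω : Fin n → Fin H → S) (s : S) : ℝ :=
  (1 / n : ℝ) * ∑ i : Fin n, (if ∃ t, ω i t = s then 1 else 0)

namespace MDP

variable {S A : Type*} [Fintype S]

/-- The weight that an initial weight `f` and one-step kernels `K t` put on each state at time `t`. -/
noncomputable def pathDist (f : S → ℝ) (K : ℕ → S → S → ℝ) : ℕ → S → ℝ
  | 0 => f
  | t + 1 => fun s => ∑ s' : S, pathDist f K t s' * K t s' s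

theorem pathDist_nonneg {f : S → ℝ} {K : ℕ → S → S → ℝ} (hf : ∀ s, 0 ≤ f s)
    (hK : ∀ t s s', 0 ≤ K t s s') (t : ℕ) (s : S) : 0 ≤ pathDist f K t s := by
  induction t generalizing s with
  | zero => exact hf s
  | succ t ih => exact sum_nonneg fun s' _ => mul_nonneg (ih s') (hK t s' s)

theorem pathDist_mono {f f' : S → ℝ} {K K' : ℕ → S → S → ℝ} (hf : ∀ s, 0 ≤ f s)
    (hK : ∀ t s s', 0 ≤ K t s s') (hff' : ∀ s, f s ≤ f' s) (hKK' : ∀ t s s', K t s s' ≤ K' t s s')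
    (t : ℕ) (s : S) : pathDist f K t s ≤ pathDist f' K' t s := by
  induction t generalizing s with
  | zero => exact hff' s
  | succ t ih =>
    exact sum_le_sum fun r _ => mul_le_mul (ih r) (hKK' t r s) (hK t r s)
      ((pathDist_nonneg hf hK t r).trans (ih r))

/-- Summing the weights of all paths gives the total weight of the terminal distribution. -/
theorem sum_path_eq (f : S → ℝ) (K : ℕ → S → S → ℝ) (m : ℕ) (g : S → ℝ) :
    ∑ τ : Fin (m + 1) → S,
      f (τ 0) * (∏ t : Fin m, K t (τ t.castSucc) (τ t.succ)) * g (τ (Fin.last m)) =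
      ∑ s, pathDist f K m s * g s := by
  induction m generalizing g with
  | zero =>
    rw [← (Equiv.funUnique (Fin 1) S).symm.sum_comp]
    simp [pathDist]
  | succ m ih =>
    rw [← (Fin.snocEquiv fun _ : Fin (m + 2) => S).sum_comp, Fintype.sum_prod_type, sum_comm]
    have h := ih fun s' => ∑ s, K m s' s * g s
    have hr : ∑ s, pathDist f K (m + 1) s * g s =
        ∑ s', pathDist f K m s' * ∑ s, K m s' s * g s := by
      simp only [pathDist, sum_mul, mul_sum]
      rw [sum_comm]
      simp only [mul_assoc]
    rw [hr, ← h]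
    refine sum_congr rfl fun τ _ => ?_
    rw [mul_sum]
    refine sum_congr rfl fun s _ => ?_
    have h0 : (Fin.snoc τ s : Fin (m + 2) → S) 0 = τ 0 := by
      rw [← Fin.castSucc_zero, Fin.snoc_castSucc (α := fun _ => S)]
    simp only [Fin.snocEquiv, Equiv.coe_fn_mk, Fin.prod_univ_castSucc, Fin.succ_last,
      Fin.succ_castSucc, Fin.snoc_castSucc (α := fun _ => S), Fin.snoc_last, h0, Fin.val_castSucc,
      Fin.val_last]
    ring

theorem sum_subtype_mem (T : Finset S) (f : S → ℝ) (hf : ∀ s ∉ T, f s = 0) :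
    ∑ s : {s : S // s ∈ T}, f s.1 = ∑ s, f s := by
  rw [Finset.sum_coe_sort T f]
  exact sum_subset (subset_univ T) fun s _ hs => hf s hs

variable [Fintype A]

/-- The state-to-state kernel induced by a policy. -/
noncomputable def polKernel (M : MDP S A) (π : Policy S A) (t : ℕ) (s s' : S) : ℝ :=
  ∑ a : A, π.p t s a * M.P s a s'

theorem polKernel_nonneg (M : MDP S A) (π : Policy S A) (t : ℕ) (s s' : S) :
    0 ≤ M.polKernel π t s s' :=
  sum_nonneg fun a _ => mul_nonneg (π.nonneg t s a) (M.P_nonneg s a s')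

theorem sum_polKernel (M : MDP S A) (π : Policy S A) (t : ℕ) (s : S) :
    ∑ s', M.polKernel π t s s' = 1 := by
  simp only [polKernel]
  rw [sum_comm]
  simp [← mul_sum, M.P_sum, π.sum_one]

theorem stateDist_eq_pathDist (M : MDP S A) (π : Policy S A) (t : ℕ) :
    stateDist M.P π.p M.ρ0 t = pathDist M.ρ0 (M.polKernel π) t := by
  induction t with
  | zero => rfl
  | succ t ih =>
    funext s
    simp only [stateDist, pathDist, polKernel, ih, mul_sum, mul_assoc]

theorem sum_stateDist (M : MDP S A) (π : Policy S A) (t : ℕ) :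
    ∑ s, stateDist M.P π.p M.ρ0 t s = 1 := by
  rw [stateDist_eq_pathDist]
  induction t with
  | zero => exact M.ρ0_sum
  | succ t ih =>
    simp only [pathDist]
    rw [sum_comm]
    simpa [← mul_sum, sum_polKernel] using ih

theorem trajProb_nonneg (M : MDP S A) (π : Policy S A) (τ : Fin M.H → S) :
    0 ≤ trajProb M π τ :=
  mul_nonneg (M.ρ0_nonneg _) (prod_nonneg fun t _ => M.polKernel_nonneg π t _ _)

variable [DecidableEq S]

/-- The weight of reaching each state at time `t` without ever leaving `T`. -/
noncomputable def survDist (M : MDP S A) (π : Policy S A) (T : Finset S) : ℕ → S → ℝ :=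
  pathDist (fun s => if s ∈ T then M.ρ0 s else 0)
    (fun t s s' => if s' ∈ T then M.polKernel π t s s' else 0)

theorem sum_trajProb_survive (M : MDP S A) (π : Policy S A) (T : Finset S) :
    ∑ τ : Fin M.H → S, trajProb M π τ * (if ∀ t, τ t ∈ T then 1 else 0) =
      ∑ s, M.survDist π T (M.H - 1) s := by
  have key : ∀ (H : ℕ) (hH : 0 < H),
      ∑ τ : Fin H → S, (M.ρ0 (τ ⟨0, hH⟩) * ∏ t : Fin (H - 1),
        M.polKernel π t.1 (τ ⟨t.1, Nat.lt_of_lt_of_le t.2 (Nat.sub_le _ _)⟩)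
          (τ ⟨t.1 + 1, by have := t.2; omega⟩)) * (if ∀ t, τ t ∈ T then 1 else 0) =
      ∑ s, M.survDist π T (H - 1) s := by
    intro H hH
    obtain ⟨m, rfl⟩ : ∃ m, H = m + 1 := ⟨H - 1, by omega⟩
    have h := sum_path_eq (fun s => if s ∈ T then M.ρ0 s else 0)
      (fun t s s' => if s' ∈ T then M.polKernel π t s s' else 0) m fun _ => 1
    simp only [mul_one] at h
    refine Eq.trans (sum_congr rfl fun τ _ => ?_) h
    by_cases hτ : ∀ t, τ t ∈ T
    · simp only [hτ, implies_true, if_true, mul_one]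
      rfl
    · rw [if_neg hτ, mul_zero]
      rw [Fin.forall_fin_succ, not_and_or] at hτ
      rcases hτ with h0 | h1
      · simp [h0]
      · push Not at h1
        obtain ⟨t, ht⟩ := h1
        rw [prod_eq_zero (mem_univ t) (if_neg ht), mul_zero]
  exact key M.H M.H_pos

theorem sum_trajProb (M : MDP S A) (π : Policy S A) :
    ∑ τ : Fin M.H → S, trajProb M π τ = 1 := by
  have h := M.sum_trajProb_survive π univ
  simp only [mem_univ, implies_true, if_true, mul_one] at h
  rw [h, ← M.sum_stateDist π (M.H - 1), stateDist_eq_pathDist]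
  simp [survDist]

/-- Union bound: an episode leaves `T` with probability at most the total hitting probability of
the complement of `T`. -/
theorem one_sub_sum_survDist_le (M : MDP S A) (π : Policy S A) (T : Finset S) :
    1 - ∑ s, M.survDist π T (M.H - 1) s ≤ ∑ s ∈ Tᶜ, hitProb M π s := by
  have hsub : 1 - ∑ s, M.survDist π T (M.H - 1) s = ∑ τ : Fin M.H → S,
      (trajProb M π τ - trajProb M π τ * (if ∀ t, τ t ∈ T then 1 else 0)) := by
    rw [sum_sub_distrib, M.sum_trajProb π, sum_trajProb_survive]
  rw [hsub]
  simp only [hitProb]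
  rw [sum_comm]
  refine sum_le_sum fun τ _ => ?_
  rw [← mul_sum]
  have hp := M.trajProb_nonneg π τ
  have hn : ∀ s ∈ Tᶜ, (0 : ℝ) ≤ if ∃ t, τ t = s then 1 else 0 := fun s _ => by
    split_ifs <;> norm_num
  by_cases hτ : ∀ t, τ t ∈ T
  · rw [if_pos hτ, mul_one, sub_self]
    exact mul_nonneg hp (sum_nonneg hn)
  · rw [if_neg hτ, mul_zero, sub_zero]
    push Not at hτ
    obtain ⟨t, ht⟩ := hτ
    refine le_mul_of_one_le_right hp ?_
    have := single_le_sum hn (mem_compl.2 ht)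
    rwa [if_pos ⟨t, rfl⟩] at this

theorem survDist_nonneg (M : MDP S A) (π : Policy S A) (T : Finset S) (t : ℕ) (s : S) :
    0 ≤ M.survDist π T t s := by
  refine pathDist_nonneg (fun s => ?_) (fun t s s' => ?_) t s
  · split_ifs
    exacts [M.ρ0_nonneg s, le_rfl]
  · split_ifs
    exacts [M.polKernel_nonneg π t s s', le_rfl]

theorem survDist_le_stateDist (M : MDP S A) (π : Policy S A) (T : Finset S) (t : ℕ) (s : S) :
    M.survDist π T t s ≤ stateDist M.P π.p M.ρ0 t s := by
  rw [stateDist_eq_pathDist]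
  refine pathDist_mono (fun s => ?_) (fun t s s' => ?_) (fun s => ?_) (fun t s s' => ?_) t s
  · split_ifs
    exacts [M.ρ0_nonneg s, le_rfl]
  · split_ifs
    exacts [M.polKernel_nonneg π t s s', le_rfl]
  · split_ifs
    exacts [le_rfl, M.ρ0_nonneg s]
  · split_ifs
    exacts [le_rfl, M.polKernel_nonneg π t s s']

theorem survDist_of_notMem (M : MDP S A) (π : Policy S A) {T : Finset S} (t : ℕ) {s : S}
    (hs : s ∉ T) : M.survDist π T t s = 0 := by
  cases t <;> simp [survDist, pathDist, hs]

theorem antitone_sum_survDist (M : MDP S A) (π : Policy S A) (T : Finset S) :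
    Antitone fun t => ∑ s, M.survDist π T t s := by
  refine antitone_nat_of_succ_le fun t => ?_
  simp only [survDist, pathDist]
  rw [sum_comm]
  refine sum_le_sum fun s _ => ?_
  rw [← mul_sum]
  refine mul_le_of_le_one_right (M.survDist_nonneg π T t s) ?_
  rw [← M.sum_polKernel π t s]
  refine sum_le_sum fun s' _ => ?_
  split_ifs
  exacts [le_rfl, M.polKernel_nonneg π t s s']

theorem stateDist_estop_some (M : MDP S A) (π : Policy S A) (T : Finset S) (t : ℕ)
    (s : {s : S // s ∈ T}) :
    stateDist (estopP M.P T) (estopPol π.p T) (estopρ0 M.ρ0 T) t (some s) =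
      M.survDist π T t s.1 := by
  induction t generalizing s with
  | zero => simp [stateDist, survDist, pathDist, estopρ0]
  | succ t ih =>
    simp only [stateDist, Fintype.sum_option, estopP, mul_zero, sum_const_zero, zero_add, ih,
      estopPol]
    rw [sum_subtype_mem T (fun s' => ∑ a, M.survDist π T t s' * π.p t s' a * M.P s' a s.1)
      fun s' hs' => by simp [M.survDist_of_notMem π t hs']]
    conv_rhs => rw [survDist, pathDist, ← survDist]
    simp only [s.2, if_true, polKernel, mul_sum, mul_assoc]

theorem estopJ_eq (M : MDP S A) (T : Finset S) (π : Policy S A) :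
    estopJ M T π = ∑ t ∈ range (M.H - 1), ∑ s, ∑ a, ∑ s',
      (if s' ∈ T then M.survDist π T t s else 0) * π.p t s a * M.P s a s' * M.R s a s' := by
  simp only [estopJ, valueJ, Fintype.sum_option, estopR, mul_zero, sum_const_zero, zero_add,
    stateDist_estop_some, estopPol, estopP]
  refine sum_congr rfl fun t _ => ?_
  rw [← sum_subtype_mem T _ fun s hs => by simp [M.survDist_of_notMem π t hs]]
  refine sum_congr rfl fun s _ => sum_congr rfl fun a _ => ?_
  rw [← sum_subtype_mem T _ fun s' hs' => by simp [hs']]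
  exact sum_congr rfl fun s' _ => by rw [if_pos s'.2]

theorem ite_survDist_le (M : MDP S A) (π : Policy S A) (T : Finset S) (t : ℕ) (s s' : S) :
    (if s' ∈ T then M.survDist π T t s else 0) ≤ stateDist M.P π.p M.ρ0 t s := by
  have h := M.survDist_le_stateDist π T t s
  split_ifs
  exacts [h, (M.survDist_nonneg π T t s).trans h]

theorem estopJ_le_J (M : MDP S A) (T : Finset S) (π : Policy S A) :
    estopJ M T π ≤ M.J π := by
  rw [estopJ_eq]
  refine sum_le_sum fun t _ => sum_le_sum fun s _ => sum_le_sum fun a _ => sum_le_sum fun s' _ => ?_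
  have := M.ite_survDist_le π T t s s'
  have h1 := π.nonneg t s a
  have h2 := M.P_nonneg s a s'
  have h3 := M.R_nonneg s a s'
  gcongr

theorem J_sub_estopJ_le (M : MDP S A) (T : Finset S) (π : Policy S A) :
    M.J π - estopJ M T π ≤ (∑ s ∈ Tᶜ, hitProb M π s) * M.H := by
  have hstep : ∀ t ∈ range (M.H - 1),
      (∑ s, ∑ a, ∑ s', stateDist M.P π.p M.ρ0 t s * π.p t s a * M.P s a s' * M.R s a s') -
        ∑ s, ∑ a, ∑ s',
          (if s' ∈ T then M.survDist π T t s else 0) * π.p t s a * M.P s a s' * M.R s a s' ≤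
        ∑ s ∈ Tᶜ, hitProb M π s := by
    intro t ht
    refine le_trans ?_ (M.one_sub_sum_survDist_le π T)
    have hmono := M.antitone_sum_survDist π T
      (show t + 1 ≤ M.H - 1 by have := mem_range.1 ht; omega)
    refine le_trans ?_ (sub_le_sub_left hmono 1)
    have hsurv : ∑ s', M.survDist π T (t + 1) s' =
        ∑ s, ∑ a, ∑ s', (if s' ∈ T then M.survDist π T t s else 0) * π.p t s a * M.P s a s' := by
      conv_lhs => simp only [survDist, pathDist]
      rw [sum_comm]
      refine sum_congr rfl fun s _ => ?_
      rw [sum_comm]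
      refine sum_congr rfl fun s' _ => ?_
      by_cases hs' : s' ∈ T
      · simp only [hs', if_true, polKernel, mul_sum, mul_assoc, survDist]
      · simp [hs']
    have hone : (1 : ℝ) =
        ∑ s, ∑ a, ∑ s', stateDist M.P π.p M.ρ0 t s * π.p t s a * M.P s a s' := by
      simp [← mul_sum, M.P_sum, π.sum_one, M.sum_stateDist]
    rw [show (fun t => ∑ s, M.survDist π T t s) (t + 1) = _ from hsurv, hone]
    simp only [← sum_sub_distrib]
    refine sum_le_sum fun s _ => sum_le_sum fun a _ => sum_le_sum fun s' _ => ?_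
    rw [← sub_mul, ← sub_mul, ← sub_mul]
    exact mul_le_of_le_one_right (mul_nonneg (mul_nonneg
      (sub_nonneg.2 (M.ite_survDist_le π T t s s')) (π.nonneg t s a)) (M.P_nonneg s a s'))
      (M.R_le_one s a s')
  have hnn : 0 ≤ ∑ s ∈ Tᶜ, hitProb M π s :=
    sum_nonneg fun s _ => sum_nonneg fun τ _ => mul_nonneg (M.trajProb_nonneg π τ) (by
      split_ifs <;> norm_num)
  rw [estopJ_eq, MDP.J, valueJ, ← sum_sub_distrib]
  refine (sum_le_card_nsmul _ _ _ hstep).trans ?_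
  rw [card_range, nsmul_eq_mul, mul_comm]
  gcongr
  omega

end MDP

open MeasureTheory ProbabilityTheory in
/-- Hoeffding's lemma for a finitely supported `[0, 1]`-valued random variable. -/
theorem sum_mul_exp_mean_sub_le {ι : Type*} [Fintype ι] {p X : ι → ℝ} (hp : ∀ i, 0 ≤ p i)
    (hp1 : ∑ i, p i = 1) (hX : ∀ i, X i ∈ Set.Icc 0 1) (l : ℝ) :
    ∑ i, p i * Real.exp (l * (∑ j, p j * X j - X i)) ≤ Real.exp (l ^ 2 / 8) := by
  let _ : MeasurableSpace ι := ⊤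
  let μ : Measure ι := ∑ i, ENNReal.ofReal (p i) • Measure.dirac i
  have hint : ∀ f : ι → ℝ, ∫ x, f x ∂μ = ∑ i, p i * f i := by
    intro f
    rw [integral_finsetSum_measure fun i _ => (integrable_dirac (by simp)).smul_measure (by simp)]
    simp [integral_smul_measure, ENNReal.toReal_ofReal (hp _)]
  have : IsProbabilityMeasure μ := ⟨by
    simp [μ, ← ENNReal.ofReal_sum_of_nonneg fun i _ => hp i, hp1]⟩
  have h := (hasSubgaussianMGF_of_mem_Icc (μ := μ) (X := X) (a := 0) (b := 1)
    (Measurable.of_discrete.aemeasurable) (ae_of_all _ hX)).mgf_le (-l)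
  simp only [mgf, hint] at h
  convert h using 2
  · ring_nf
  · norm_num
    ring

/-- One-sided Hoeffding inequality for the empirical mean of `n` i.i.d. finitely supported samples
in `[0, 1]`. -/
theorem sum_prod_mean_sub_gt_le {ι : Type*} [Fintype ι] {p X : ι → ℝ} (hp : ∀ i, 0 ≤ p i)
    (hp1 : ∑ i, p i = 1) (hX : ∀ i, X i ∈ Set.Icc 0 1) {n : ℕ} (hn : 0 < n) {δ : ℝ} (hδ : 0 < δ) :
    ∑ ω : Fin n → ι, (∏ k, p (ω k)) *
      (if δ < ∑ j, p j * X j - (1 / n : ℝ) * ∑ k, X (ω k) then 1 else 0) ≤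
      Real.exp (-2 * δ ^ 2 * n) := by
  classical
  set m := ∑ j, p j * X j
  have hn' : (0 : ℝ) < n := by exact_mod_cast hn
  calc _ ≤ ∑ ω : Fin n → ι, (∏ k, p (ω k)) *
        (Real.exp (-(4 * δ ^ 2 * n)) * ∏ k, Real.exp (4 * δ * (m - X (ω k)))) := by
        refine sum_le_sum fun ω _ => mul_le_mul_of_nonneg_left ?_ (prod_nonneg fun k _ => hp _)
        rw [← Real.exp_sum, ← Real.exp_add]
        split_ifs with h
        · rw [Real.one_le_exp_iff, ← mul_sum, sum_sub_distrib]
          have h1 : n * δ < n * (m - (1 / n : ℝ) * ∑ k, X (ω k)) := by gcongr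
          rw [mul_sub, ← mul_assoc, mul_one_div_cancel hn'.ne', one_mul] at h1
          simp only [sum_const, card_univ, Fintype.card_fin, nsmul_eq_mul]
          nlinarith
        · positivity
    _ = Real.exp (-(4 * δ ^ 2 * n)) * (∑ i, p i * Real.exp (4 * δ * (m - X i))) ^ n := by
        rw [← Fin.prod_const n (∑ i, _), Finset.prod_univ_sum, mul_sum, Fintype.piFinset_univ]
        refine sum_congr rfl fun ω _ => ?_
        rw [prod_mul_distrib]
        ring
    _ ≤ Real.exp (-(4 * δ ^ 2 * n)) * Real.exp ((4 * δ) ^ 2 / 8) ^ n := by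
        gcongr
        · exact sum_nonneg fun i _ => mul_nonneg (hp i) (Real.exp_nonneg _)
        · exact sum_mul_exp_mean_sub_le hp hp1 hX _
    _ = Real.exp (-2 * δ ^ 2 * n) := by
        rw [← Real.exp_nat_mul, ← Real.exp_add]
        ring_nf

/-- learned e-stops from `n` expert demonstrations. If (sample-dependent)
`Ŝ` removes states of total empirical hitting probability at most `ξ`, then with
probability at least `1 − |S|·exp(−2ε²n/|S|²)` over the `n` i.i.d. expert trajectories,
the optimal e-stop policy satisfies `J_M(π_e) − J_M(π̂*) ≤ (ξ + ε)·H`. -/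
theorem learned_estop
    {S A : Type*} [Fintype S] [DecidableEq S] [Fintype A]
    (M : MDP S A) (πe : Policy S A)
    (ξ ε : ℝ) (hξ : 0 ≤ ξ) (hε : 0 < ε)
    (n : ℕ) (hn : 0 < n)
    (Shat : (Fin n → Fin M.H → S) → Finset S)
    (hShat : ∀ ω, ∑ s ∈ (Shat ω)ᶜ, empHit ω s ≤ ξ)
    (πhatstar : (Fin n → Fin M.H → S) → Policy S A)
    (hπhatstar : ∀ ω (π : Policy S A),
      estopJ M (Shat ω) π ≤ estopJ M (Shat ω) (πhatstar ω)) :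
    1 - (Fintype.card S : ℝ) * Real.exp (-2 * ε ^ 2 * n / (Fintype.card S : ℝ) ^ 2) ≤
      ∑ ω : Fin n → Fin M.H → S,
        (∏ i : Fin n, trajProb M πe (ω i)) *
          (if M.J πe - M.J (πhatstar ω) ≤ (ξ + ε) * M.H then 1 else 0) := by
  have hcard : (0 : ℝ) < Fintype.card S := by
    rw [Nat.cast_pos, Fintype.card_pos_iff]
    by_contra hS
    rw [not_nonempty_iff] at hS
    simpa using M.ρ0_sum
  set δ : ℝ := ε / Fintype.card S with hδ_def
  have hδ : 0 < δ := div_pos hε hcard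
  have hW : ∀ ω : Fin n → Fin M.H → S, 0 ≤ ∏ i, trajProb M πe (ω i) := fun ω =>
    prod_nonneg fun i _ => M.trajProb_nonneg πe _
  have hW1 : ∑ ω : Fin n → Fin M.H → S, ∏ i, trajProb M πe (ω i) = 1 := by
    rw [← Fintype.piFinset_univ, ← Finset.prod_univ_sum]
    simp [M.sum_trajProb]
  have hbad : ∀ s, ∑ ω : Fin n → Fin M.H → S, (∏ i, trajProb M πe (ω i)) *
      (if δ < hitProb M πe s - empHit ω s then 1 else 0) ≤ Real.exp (-2 * δ ^ 2 * n) := by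
    intro s
    have h := sum_prod_mean_sub_gt_le (M.trajProb_nonneg πe) (M.sum_trajProb πe)
      (X := fun τ => if ∃ t, τ t = s then 1 else 0) (fun τ => by split_ifs <;> simp) hn hδ
    unfold hitProb empHit
    exact h
  have hgood : ∀ ω, (∀ s, hitProb M πe s - empHit ω s ≤ δ) →
      M.J πe - M.J (πhatstar ω) ≤ (ξ + ε) * M.H := by
    intro ω h
    have h1 := M.estopJ_le_J (Shat ω) (πhatstar ω)
    have h2 := hπhatstar ω πe
    have h3 := M.J_sub_estopJ_le (Shat ω) πe
    have h4 : ∑ s ∈ (Shat ω)ᶜ, hitProb M πe s ≤ ξ + ε := by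
      calc _ ≤ ∑ s ∈ (Shat ω)ᶜ, (empHit ω s + δ) :=
            sum_le_sum fun s _ => by linarith [h s]
        _ = ∑ s ∈ (Shat ω)ᶜ, empHit ω s + #(Shat ω)ᶜ * δ := by
            rw [sum_add_distrib, sum_const, nsmul_eq_mul]
        _ ≤ ξ + Fintype.card S * δ := by
            gcongr
            · exact hShat ω
            · exact card_le_univ _
        _ = ξ + ε := by rw [hδ_def, mul_div_cancel₀ _ hcard.ne']
    have h5 : (∑ s ∈ (Shat ω)ᶜ, hitProb M πe s) * M.H ≤ (ξ + ε) * M.H := by gcongr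
    linarith
  have hexp : -2 * ε ^ 2 * n / (Fintype.card S : ℝ) ^ 2 = -2 * δ ^ 2 * n := by
    rw [hδ_def, div_pow]
    ring
  rw [hexp]
  calc _ ≤ 1 - ∑ s, ∑ ω : Fin n → Fin M.H → S, (∏ i, trajProb M πe (ω i)) *
        (if δ < hitProb M πe s - empHit ω s then 1 else 0) := by
        have := sum_le_card_nsmul univ _ _ fun s _ => hbad s
        rw [nsmul_eq_mul, card_univ] at this
        linarith
    _ = ∑ ω : Fin n → Fin M.H → S, (∏ i, trajProb M πe (ω i)) *
        (1 - ∑ s, if δ < hitProb M πe s - empHit ω s then (1 : ℝ) else 0) := by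
        simp only [mul_sub, mul_one, mul_sum, sum_sub_distrib, hW1]
        rw [sum_comm]
    _ ≤ _ := by
        refine sum_le_sum fun ω _ => mul_le_mul_of_nonneg_left ?_ (hW ω)
        have hn0 : ∀ s ∈ univ, (0 : ℝ) ≤
            if δ < hitProb M πe s - empHit ω s then 1 else 0 := fun s _ => by
          split_ifs <;> norm_num
        by_cases h : ∀ s, hitProb M πe s - empHit ω s ≤ δ
        · rw [if_pos (hgood ω h)]
          linarith [sum_nonneg hn0]
        · push Not at h
          obtain ⟨s, hs⟩ := h
          have h1 := single_le_sum hn0 (mem_univ s)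
          rw [if_pos hs] at h1
          refine le_trans (sub_nonpos.2 h1) ?_
          split_ifs <;> norm_num
end
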